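/- Let A₁ : D(A₁) ⊆ H₁ → H₂ and A₂ : D(A₂) ⊆ H₂ → H₃ be densely defined closed linear operators with R(A₁) ⊆ N(A₂) and with R(A₁) and R(A₂) closed. Let f ∈ H₂, g ∈ H₁, k ∈ H₂. Then the second order system A₂*A₂x = f, A₁*x = g, πx = k has a (necessarily unique) solution x ∈ D(A₁*) ∩ D(A₂) with A₂x ∈ D(A₂*) if and only if f ∈ R(A₂*), g ∈ R(A₁*), and k ∈ K₂. The solution satisfies x = x_f + x_g + k with x_f = π_{R(A₂*)}x, x_g = π_{R(A₁)}x, ‖x‖²_{H₂} = ‖x_f‖²_{H₂} + ‖x_g‖²_{H₂} + ‖k‖²_{H₂}, and the stability estimates ‖x_f‖_{H₂} ≤ c₂²‖f‖_{H₂}, ‖x_g‖_{H₂} ≤ c₁‖g‖_{H₁}, hence ‖x‖_{H₂} ≤ c₂²‖f‖_{H₂} + c₁‖g‖_{H₁} + ‖k‖_{H₂}. -/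

import Mathlib

open Submodule LinearPMap RealInnerProductSpace

noncomputable section

/-- The range of a partially defined linear operator, as a submodule. -/
def pRan {E F : Type*} [AddCommGroup E] [Module ℝ E] [AddCommGroup F] [Module ℝ F]
    (A : E →ₗ.[ℝ] F) : Submodule ℝ F :=
  LinearMap.range A.toFun

/-- The kernel of a partially defined linear operator, as a submodule of the ambient space. -/
def pKer {E F : Type*} [AddCommGroup E] [Module ℝ E] [AddCommGroup F] [Module ℝ F]
    (A : E →ₗ.[ℝ] F) : Submodule ℝ E :=
  (LinearMap.ker A.toFun).map A.domain.subtype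

variable {H₁ H₂ H₃ : Type*}
  [NormedAddCommGroup H₁] [InnerProductSpace ℝ H₁] [CompleteSpace H₁]
  [NormedAddCommGroup H₂] [InnerProductSpace ℝ H₂] [CompleteSpace H₂]
  [NormedAddCommGroup H₃] [InnerProductSpace ℝ H₃] [CompleteSpace H₃]

/-- `x` solves the second order system `A₂† A₂ x = f`, `A₁† x = g`, `π x = k`, where `π` is the
orthogonal projection onto `K₂ = N(A₂) ∩ N(A₁†)`. -/
def IsSecondOrderSol (A₁ : H₁ →ₗ.[ℝ] H₂) (A₂ : H₂ →ₗ.[ℝ] H₃) (f : H₂) (g : H₁) (k x : H₂) :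
    Prop :=
  ∃ (hx₂ : x ∈ A₂.domain) (hx₁ : x ∈ (A₁†).domain) (hxx : A₂ ⟨x, hx₂⟩ ∈ (A₂†).domain),
    A₂† ⟨A₂ ⟨x, hx₂⟩, hxx⟩ = f ∧ A₁† ⟨x, hx₁⟩ = g ∧
      k ∈ pKer A₂ ⊓ pKer (A₁†) ∧ x - k ∈ (pKer A₂ ⊓ pKer (A₁†))ᗮ

section GraphLemmas

variable {E F : Type*}
  [NormedAddCommGroup E] [InnerProductSpace ℝ E]
  [NormedAddCommGroup F] [InnerProductSpace ℝ F]

theorem mem_pKer_iff {A : E →ₗ.[ℝ] F} {x : E} : x ∈ pKer A ↔ (x, (0 : F)) ∈ A.graph := by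
  constructor
  · rintro ⟨v, hv, rfl⟩
    exact (LinearPMap.mem_graph_iff A).2 ⟨v, rfl, hv⟩
  · intro h
    obtain ⟨v, hv, hv0⟩ := (LinearPMap.mem_graph_iff A).1 h
    exact ⟨v, hv0, hv⟩

theorem mem_pRan_iff {A : E →ₗ.[ℝ] F} {y : F} : y ∈ pRan A ↔ ∃ x, (x, y) ∈ A.graph := by
  constructor
  · rintro ⟨v, rfl⟩
    exact ⟨v, A.mem_graph v⟩
  · rintro ⟨x, h⟩
    obtain ⟨v, -, hv⟩ := (LinearPMap.mem_graph_iff A).1 h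
    exact ⟨v, hv⟩

theorem isClosed_pKer {A : E →ₗ.[ℝ] F} (hA : A.IsClosed) : IsClosed (pKer A : Set E) := by
  have h : (pKer A : Set E) = (fun x : E => (x, (0 : F))) ⁻¹' (A.graph : Set (E × F)) :=
    Set.ext fun _ => mem_pKer_iff
  rw [h]
  exact IsClosed.preimage (by fun_prop) hA

/-- A bound for `A` on the orthogonal complement of a subspace, in terms of the graph. -/
theorem norm_le_of_mem_graph {A : E →ₗ.[ℝ] F} {K : Submodule ℝ E} {c : ℝ}
    (hc : ∀ v : A.domain, (v : E) ∈ Kᗮ → ‖(v : E)‖ ≤ c * ‖A v‖)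
    {x : E} {y : F} (h : (x, y) ∈ A.graph) (hx : x ∈ Kᗮ) : ‖x‖ ≤ c * ‖y‖ := by
  obtain ⟨v, rfl, rfl⟩ := (LinearPMap.mem_graph_iff A).1 h
  exact hc v hx

/-- Every value of a closed operator is attained on the orthogonal complement of its kernel. -/
theorem exists_mem_orthogonal_pKer [CompleteSpace E] {A : E →ₗ.[ℝ] F} (hA : A.IsClosed)
    {x : E} {y : F} (h : (x, y) ∈ A.graph) :
    ∃ u ∈ (pKer A)ᗮ, x - u ∈ pKer A ∧ (u, y) ∈ A.graph := by
  have : CompleteSpace (pKer A) := (isClosed_pKer hA).completeSpace_coe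
  have hp : (pKer A).starProjection x ∈ pKer A := Submodule.starProjection_apply_mem _ _
  refine ⟨x - (pKer A).starProjection x, Submodule.sub_starProjection_mem_orthogonal x,
    by simp, ?_⟩
  simpa using A.graph.sub_mem h (mem_pKer_iff.1 hp)

variable [CompleteSpace E]

theorem mem_adjoint_graph_iff {A : E →ₗ.[ℝ] F} (hd : Dense (A.domain : Set E)) {y : F} {w : E} :
    (y, w) ∈ A†.graph ↔ ∀ x z, (x, z) ∈ A.graph → ⟪z, y⟫ = ⟪x, w⟫ := by
  rw [LinearPMap.adjoint_graph_eq_graph_adjoint hd, Submodule.mem_adjoint_iff]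
  simp only [sub_eq_zero]

theorem pKer_adjoint {A : E →ₗ.[ℝ] F} (hd : Dense (A.domain : Set E)) :
    pKer (A†) = (pRan A)ᗮ := by
  ext y
  rw [mem_pKer_iff, mem_adjoint_graph_iff hd, Submodule.mem_orthogonal]
  simp only [mem_pRan_iff, inner_zero_right]
  grind

theorem pRan_adjoint_le {A : E →ₗ.[ℝ] F} (hd : Dense (A.domain : Set E)) :
    pRan (A†) ≤ (pKer A)ᗮ := by
  intro w hw
  obtain ⟨y, hy⟩ := mem_pRan_iff.1 hw
  rw [Submodule.mem_orthogonal]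
  intro x hx
  rw [← (mem_adjoint_graph_iff hd).1 hy x 0 (mem_pKer_iff.1 hx), inner_zero_left]

/-- Closed range theorem: an element orthogonal to the kernel of `A` is the image under `A†` of
an element of the range of `A`. -/
theorem exists_mem_pRan_adjoint_graph [CompleteSpace F] {A : E →ₗ.[ℝ] F}
    (hd : Dense (A.domain : Set E)) (hA : A.IsClosed) (hr : IsClosed (pRan A : Set F)) {c : ℝ}
    (hc : ∀ v : A.domain, (v : E) ∈ (pKer A)ᗮ → ‖(v : E)‖ ≤ c * ‖A v‖)
    {w : E} (hw : w ∈ (pKer A)ᗮ) : ∃ y ∈ pRan A, (y, w) ∈ A†.graph := by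
  have : CompleteSpace (pRan A) := hr.completeSpace_coe
  obtain ⟨s, hs⟩ := A.toFun.rangeRestrict.exists_rightInverse_of_surjective
    A.toFun.range_rangeRestrict
  have hsA (u : pRan A) : ((s u : E), (u : F)) ∈ A.graph :=
    (LinearPMap.mem_graph_iff A).2 ⟨s u, rfl, congrArg Subtype.val (LinearMap.congr_fun hs u)⟩
  have inner_eq {a b : E} (h : a - b ∈ pKer A) : ⟪w, a⟫ = ⟪w, b⟫ := by
    rw [← sub_eq_zero, ← inner_sub_right]
    exact Submodule.inner_left_of_mem_orthogonal h hw
  let l : pRan A →ₗ[ℝ] ℝ := (innerₛₗ ℝ w) ∘ₗ A.domain.subtype ∘ₗ s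
  have hl (u : pRan A) : l u = ⟪w, (s u : E)⟫ := rfl
  let L : StrongDual ℝ (pRan A) := l.mkContinuous (‖w‖ * c) fun u => by
    obtain ⟨v, hv, hsv, hvu⟩ := exists_mem_orthogonal_pKer hA (hsA u)
    rw [hl, inner_eq hsv, mul_assoc]
    exact (norm_inner_le_norm w v).trans
      (mul_le_mul_of_nonneg_left (norm_le_of_mem_graph hc hvu hv) (norm_nonneg w))
  let y : pRan A := (InnerProductSpace.toDual ℝ (pRan A)).symm L
  refine ⟨y, y.2, (mem_adjoint_graph_iff hd).2 fun x z hxz => ?_⟩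
  let u : pRan A := ⟨z, mem_pRan_iff.2 ⟨x, hxz⟩⟩
  have hyu : ⟪y, u⟫ = L u := InnerProductSpace.toDual_symm_apply
  have hk : (s u : E) - x ∈ pKer A := by
    rw [mem_pKer_iff]
    simpa [u] using A.graph.sub_mem (hsA u) hxz
  calc ⟪z, (y : F)⟫ = ⟪y, u⟫ := real_inner_comm _ _
    _ = ⟪w, (s u : E)⟫ := hyu
    _ = ⟪x, w⟫ := by rw [inner_eq hk, real_inner_comm]

theorem pRan_le_orthogonal_pKer_adjoint {A : E →ₗ.[ℝ] F} (hd : Dense (A.domain : Set E)) :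
    pRan A ≤ (pKer (A†))ᗮ := by
  rw [pKer_adjoint hd]
  exact Submodule.le_orthogonal_orthogonal _

end GraphLemmas

theorem isSecondOrderSol_iff {A₁ : H₁ →ₗ.[ℝ] H₂} {A₂ : H₂ →ₗ.[ℝ] H₃} {f : H₂} {g : H₁}
    {k x : H₂} :
    IsSecondOrderSol A₁ A₂ f g k x ↔
      (∃ y, (x, y) ∈ A₂.graph ∧ (y, f) ∈ A₂†.graph) ∧ (x, g) ∈ A₁†.graph ∧
        k ∈ pKer A₂ ⊓ pKer (A₁†) ∧ x - k ∈ (pKer A₂ ⊓ pKer (A₁†))ᗮ := by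
  constructor
  · rintro ⟨hx₂, hx₁, hxx, hf, hg, hk⟩
    exact ⟨⟨A₂ ⟨x, hx₂⟩, A₂.mem_graph ⟨x, hx₂⟩, (LinearPMap.mem_graph_iff _).2 ⟨_, rfl, hf⟩⟩,
      (LinearPMap.mem_graph_iff _).2 ⟨_, rfl, hg⟩, hk⟩
  · rintro ⟨⟨y, hxy, hyf⟩, hg, hk⟩
    obtain ⟨⟨x, hx₂⟩, rfl, rfl⟩ := (LinearPMap.mem_graph_iff _).1 hxy
    obtain ⟨⟨_, hxx⟩, rfl, hf⟩ := (LinearPMap.mem_graph_iff _).1 hyf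
    obtain ⟨⟨_, hx₁⟩, rfl, hg⟩ := (LinearPMap.mem_graph_iff _).1 hg
    exact ⟨hx₂, hx₁, hxx, hf, hg, hk⟩

theorem IsSecondOrderSol.sub {A₁ : H₁ →ₗ.[ℝ] H₂} {A₂ : H₂ →ₗ.[ℝ] H₃} {f f' : H₂} {g g' : H₁}
    {k k' x x' : H₂} (h : IsSecondOrderSol A₁ A₂ f g k x)
    (h' : IsSecondOrderSol A₁ A₂ f' g' k' x') :
    IsSecondOrderSol A₁ A₂ (f - f') (g - g') (k - k') (x - x') := by
  rw [isSecondOrderSol_iff] at *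
  obtain ⟨⟨y, hxy, hyf⟩, hg, hk, hxk⟩ := h
  obtain ⟨⟨y', hxy', hyf'⟩, hg', hk', hxk'⟩ := h'
  refine ⟨⟨y - y', A₂.graph.sub_mem hxy hxy', A₂†.graph.sub_mem hyf hyf'⟩,
    A₁†.graph.sub_mem hg hg', sub_mem hk hk', ?_⟩
  rw [sub_sub_sub_comm]
  exact sub_mem hxk hxk'

theorem exists_isSecondOrderSol {A₁ : H₁ →ₗ.[ℝ] H₂} {A₂ : H₂ →ₗ.[ℝ] H₃}
    (hdense₁ : Dense (A₁.domain : Set H₁)) (hdense₂ : Dense (A₂.domain : Set H₂))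
    (hclosed₁ : A₁.IsClosed) (hclosed₂ : A₂.IsClosed)
    (hcomplex : pRan A₁ ≤ pKer A₂)
    (hrange₁ : IsClosed (pRan A₁ : Set H₂)) (hrange₂ : IsClosed (pRan A₂ : Set H₃)) {c₁ c₂ : ℝ}
    (hc₁ : ∀ v : A₁.domain, (v : H₁) ∈ (pKer A₁)ᗮ → ‖(v : H₁)‖ ≤ c₁ * ‖A₁ v‖)
    (hc₂ : ∀ v : A₂.domain, (v : H₂) ∈ (pKer A₂)ᗮ → ‖(v : H₂)‖ ≤ c₂ * ‖A₂ v‖)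
    {f : H₂} {g : H₁} {k : H₂} (hf : f ∈ pRan (A₂†)) (hg : g ∈ pRan (A₁†))
    (hk : k ∈ pKer A₂ ⊓ pKer (A₁†)) : ∃ x, IsSecondOrderSol A₁ A₂ f g k x := by
  obtain ⟨y, hy, hyf⟩ := exists_mem_pRan_adjoint_graph hdense₂ hclosed₂ hrange₂ hc₂
    (pRan_adjoint_le hdense₂ hf)
  obtain ⟨z, hz, hzg⟩ := exists_mem_pRan_adjoint_graph hdense₁ hclosed₁ hrange₁ hc₁
    (pRan_adjoint_le hdense₁ hg)
  obtain ⟨v, hv⟩ := mem_pRan_iff.1 hy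
  obtain ⟨u, hu, -, huy⟩ := exists_mem_orthogonal_pKer hclosed₂ hv
  have hu₁ : u ∈ pKer (A₁†) := by
    rw [pKer_adjoint hdense₁]
    exact Submodule.orthogonal_le hcomplex hu
  refine ⟨u + z + k, isSecondOrderSol_iff.2 ⟨⟨y, ?_, hyf⟩, ?_, hk, ?_⟩⟩
  · simpa using A₂.graph.add_mem (A₂.graph.add_mem huy (mem_pKer_iff.1 (hcomplex hz)))
      (mem_pKer_iff.1 hk.1)
  · simpa using A₁†.graph.add_mem (A₁†.graph.add_mem (mem_pKer_iff.1 hu₁) hzg)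
      (mem_pKer_iff.1 hk.2)
  · rw [add_sub_cancel_right]
    exact add_mem (Submodule.orthogonal_le inf_le_left hu)
      (Submodule.orthogonal_le inf_le_right (pRan_le_orthogonal_pKer_adjoint hdense₁ hz))

theorem IsSecondOrderSol.exists_decomposition {A₁ : H₁ →ₗ.[ℝ] H₂} {A₂ : H₂ →ₗ.[ℝ] H₃}
    (hdense₁ : Dense (A₁.domain : Set H₁)) (hdense₂ : Dense (A₂.domain : Set H₂))
    (hclosed₂ : A₂.IsClosed) (hcomplex : pRan A₁ ≤ pKer A₂)
    (hrange₁ : IsClosed (pRan A₁ : Set H₂)) (hrange₂ : IsClosed (pRan A₂ : Set H₃))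
    {c₁ c₂ : ℝ} (hc₂pos : 0 < c₂)
    (hc₁adj : ∀ w : (A₁†).domain, (w : H₂) ∈ (pKer (A₁†))ᗮ → ‖(w : H₂)‖ ≤ c₁ * ‖A₁† w‖)
    (hc₂ : ∀ v : A₂.domain, (v : H₂) ∈ (pKer A₂)ᗮ → ‖(v : H₂)‖ ≤ c₂ * ‖A₂ v‖)
    (hc₂adj : ∀ w : (A₂†).domain, (w : H₃) ∈ (pKer (A₂†))ᗮ → ‖(w : H₃)‖ ≤ c₂ * ‖A₂† w‖)
    {f : H₂} {g : H₁} {k x : H₂} (h : IsSecondOrderSol A₁ A₂ f g k x) :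
    ∃ xf xg : H₂, x = xf + xg + k
      ∧ xf ∈ pRan (A₂†) ∧ x - xf ∈ (pRan (A₂†))ᗮ
      ∧ xg ∈ pRan A₁ ∧ x - xg ∈ (pRan A₁)ᗮ
      ∧ ‖x‖ ^ 2 = ‖xf‖ ^ 2 + ‖xg‖ ^ 2 + ‖k‖ ^ 2
      ∧ ‖xf‖ ≤ c₂ ^ 2 * ‖f‖ ∧ ‖xg‖ ≤ c₁ * ‖g‖
      ∧ ‖x‖ ≤ c₂ ^ 2 * ‖f‖ + c₁ * ‖g‖ + ‖k‖ := by
  obtain ⟨⟨y, hxy, hyf⟩, hg, hk, hxk⟩ := isSecondOrderSol_iff.1 h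
  have : CompleteSpace (pRan A₁) := hrange₁.completeSpace_coe
  obtain ⟨xf, hxf, hxxf, hxfy⟩ := exists_mem_orthogonal_pKer hclosed₂ hxy
  obtain ⟨xg, hxg, hxxg⟩ : ∃ xg ∈ pRan A₁, x - xg ∈ (pRan A₁)ᗮ :=
    ⟨(pRan A₁).starProjection x, Submodule.starProjection_apply_mem _ _,
      Submodule.sub_starProjection_mem_orthogonal x⟩
  have hxf₁ : xf ∈ (pRan A₁)ᗮ := Submodule.orthogonal_le hcomplex hxf
  have hxg₁ : xg ∈ (pKer (A₁†))ᗮ := pRan_le_orthogonal_pKer_adjoint hdense₁ hxg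
  have hr : x - xf - xg ∈ pKer A₂ ⊓ pKer (A₁†) := by
    refine ⟨sub_mem hxxf (hcomplex hxg), ?_⟩
    rw [SetLike.mem_coe, pKer_adjoint hdense₁, sub_right_comm]
    exact sub_mem hxxg hxf₁
  have hfg : xf + xg ∈ (pKer A₂ ⊓ pKer (A₁†))ᗮ :=
    add_mem (Submodule.orthogonal_le inf_le_left hxf) (Submodule.orthogonal_le inf_le_right hxg₁)
  have hrk : x - xf - xg - k = 0 := by
    refine inner_self_eq_zero.1
      (Submodule.inner_right_of_mem_orthogonal (𝕜 := ℝ) (sub_mem hr hk) ?_)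
    have e : x - xf - xg - k = x - k - (xf + xg) := by abel
    rw [e]
    exact sub_mem hxk hfg
  have hx : x = xf + xg + k := by
    rw [← sub_eq_zero, ← hrk]
    abel
  have hxfA : xf ∈ pRan (A₂†) := by
    obtain ⟨z, -, hz⟩ := exists_mem_pRan_adjoint_graph hdense₂ hclosed₂ hrange₂ hc₂ hxf
    exact mem_pRan_iff.2 ⟨z, hz⟩
  have hxgg : (xg, g) ∈ A₁†.graph := by
    rw [← pKer_adjoint hdense₁] at hxf₁
    have e : xg = x - xf - k := by rw [hx]; abel
    rw [e]
    simpa using A₁†.graph.sub_mem (A₁†.graph.sub_mem hg (mem_pKer_iff.1 hxf₁))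
      (mem_pKer_iff.1 hk.2)
  have hy : ‖y‖ ≤ c₂ * ‖f‖ := norm_le_of_mem_graph hc₂adj hyf
    (pRan_le_orthogonal_pKer_adjoint hdense₂ (mem_pRan_iff.2 ⟨x, hxy⟩))
  have hbf : ‖xf‖ ≤ c₂ ^ 2 * ‖f‖ := by
    refine (norm_le_of_mem_graph hc₂ hxfy hxf).trans ?_
    rw [pow_two, mul_assoc]
    exact mul_le_mul_of_nonneg_left hy hc₂pos.le
  have hbg : ‖xg‖ ≤ c₁ * ‖g‖ := norm_le_of_mem_graph hc₁adj hxgg hxg₁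
  refine ⟨xf, xg, hx, hxfA, ?_, hxg, hxxg, ?_, hbf, hbg, ?_⟩
  · exact Submodule.orthogonal_le (pRan_adjoint_le hdense₂)
      (Submodule.le_orthogonal_orthogonal _ hxxf)
  · have h₁ : ⟪xf + xg, k⟫ = 0 := Submodule.inner_left_of_mem_orthogonal hk hfg
    have h₂ : ⟪xf, xg⟫ = 0 := Submodule.inner_left_of_mem_orthogonal hxg hxf₁
    rw [hx, norm_add_sq_real, norm_add_sq_real, h₁, h₂]
    ring
  · calc ‖x‖ = ‖xf + xg + k‖ := by rw [← hx]
      _ ≤ ‖xf‖ + ‖xg‖ + ‖k‖ := norm_add₃_le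
      _ ≤ c₂ ^ 2 * ‖f‖ + c₁ * ‖g‖ + ‖k‖ := by gcongr

/-- Solution theory for the second order system `A₂† A₂ x = f`, `A₁† x = g`,
`π x = k`: solvability is equivalent to `f ∈ R(A₂†)`, `g ∈ R(A₁†)`, `k ∈ K₂`; the solution is
unique and decomposes as `x = x_f + x_g + k` with `x_f = π_{R(A₂†)} x`, `x_g = π_{R(A₁)} x`,
orthogonal norm decomposition, and stability `‖x_f‖ ≤ c₂²‖f‖`, `‖x_g‖ ≤ c₁‖g‖`,
`‖x‖ ≤ c₂²‖f‖ + c₁‖g‖ + ‖k‖`. -/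
theorem statement10 (A₁ : H₁ →ₗ.[ℝ] H₂) (A₂ : H₂ →ₗ.[ℝ] H₃)
    (hdense₁ : Dense (A₁.domain : Set H₁)) (hdense₂ : Dense (A₂.domain : Set H₂))
    (hclosed₁ : A₁.IsClosed) (hclosed₂ : A₂.IsClosed)
    (hcomplex : pRan A₁ ≤ pKer A₂)
    (hrange₁ : IsClosed (pRan A₁ : Set H₂)) (hrange₂ : IsClosed (pRan A₂ : Set H₃))
    (c₁ c₂ : ℝ) (hc₁pos : 0 < c₁) (hc₂pos : 0 < c₂)
    (hc₁ : ∀ v : A₁.domain, (v : H₁) ∈ (pKer A₁)ᗮ → ‖(v : H₁)‖ ≤ c₁ * ‖A₁ v‖)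
    (hc₁adj : ∀ w : (A₁†).domain, (w : H₂) ∈ (pKer (A₁†))ᗮ → ‖(w : H₂)‖ ≤ c₁ * ‖A₁† w‖)
    (hc₂ : ∀ v : A₂.domain, (v : H₂) ∈ (pKer A₂)ᗮ → ‖(v : H₂)‖ ≤ c₂ * ‖A₂ v‖)
    (hc₂adj : ∀ w : (A₂†).domain, (w : H₃) ∈ (pKer (A₂†))ᗮ → ‖(w : H₃)‖ ≤ c₂ * ‖A₂† w‖)
    (f : H₂) (g : H₁) (k : H₂) :
    -- solvability is equivalent to the compatibility conditions on the data
    ((∃ x : H₂, IsSecondOrderSol A₁ A₂ f g k x) ↔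
      (f ∈ pRan (A₂†) ∧ g ∈ pRan (A₁†) ∧ k ∈ pKer A₂ ⊓ pKer (A₁†)))
    -- uniqueness of the solution
    ∧ (∀ x x' : H₂, IsSecondOrderSol A₁ A₂ f g k x → IsSecondOrderSol A₁ A₂ f g k x' → x = x')
    -- decomposition and estimates for the solution
    ∧ (∀ x : H₂, IsSecondOrderSol A₁ A₂ f g k x →
        ∃ xf xg : H₂,
          x = xf + xg + k
          -- `x_f = π_{R(A₂†)} x` and `x_g = π_{R(A₁)} x`
          ∧ xf ∈ pRan (A₂†) ∧ x - xf ∈ (pRan (A₂†))ᗮ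
          ∧ xg ∈ pRan A₁ ∧ x - xg ∈ (pRan A₁)ᗮ
          -- the norm decomposes orthogonally
          ∧ ‖x‖ ^ 2 = ‖xf‖ ^ 2 + ‖xg‖ ^ 2 + ‖k‖ ^ 2
          -- stability estimates
          ∧ ‖xf‖ ≤ c₂ ^ 2 * ‖f‖ ∧ ‖xg‖ ≤ c₁ * ‖g‖
          ∧ ‖x‖ ≤ c₂ ^ 2 * ‖f‖ + c₁ * ‖g‖ + ‖k‖) := by
  have decomp {f : H₂} {g : H₁} {k x : H₂} (h : IsSecondOrderSol A₁ A₂ f g k x) :=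
    h.exists_decomposition hdense₁ hdense₂ hclosed₂ hcomplex hrange₁ hrange₂ hc₂pos
      hc₁adj hc₂ hc₂adj
  refine ⟨⟨?_, ?_⟩, fun x x' h h' => ?_, fun x h => decomp h⟩
  · rintro ⟨x, hx₂, hx₁, hxx, hf, hg, hk, -⟩
    exact ⟨⟨_, hf⟩, ⟨_, hg⟩, hk⟩
  · rintro ⟨hf, hg, hk⟩
    exact exists_isSecondOrderSol hdense₁ hdense₂ hclosed₁ hclosed₂ hcomplex hrange₁ hrange₂
      hc₁ hc₂ hf hg hk
  · obtain ⟨_, _, -, -, -, -, -, -, -, -, hn⟩ := decomp (h.sub h')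
    simpa [sub_eq_zero] using hn
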